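/- arXiv:2507.20061 — 6 statements merged into one kernel-verified Lean document; each statement's English description precedes it below -/
import Mathlib

section
/- Let E = ℝ^d be Euclidean space, let D ⊆ E be a nonempty closed convex set, let c > 0, and let x, e ∈ E. Set z' = x + (1/(2c)) • e and define the utility u(z) = (if z ∈ D then ⟨z, e⟩ else 0) − c‖z − x‖². If z' ∈ D and ⟨z', e⟩ ≥ ‖e‖²/(4c), then u(z) ≤ u(z') for every z ∈ E; that is, the ideal point z' is a best response of the user. -/
open scoped RealInnerProductSpace
open Classical

/-- If the ideal point `z' = x + e/(2c)` is benign and its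
trend-alignment reward `⟪z', e⟫` is at least `‖e‖²/(4c)`, then `z'` is a best
response: it maximizes `u(z) = 1[z ∈ D]·⟪z, e⟫ − c‖z − x‖²` over all of `E`. -/
theorem ideal_point_is_best_response {d : ℕ}
    (D : Set (EuclideanSpace ℝ (Fin d))) (hne : D.Nonempty)
    (hclosed : IsClosed D) (hconv : Convex ℝ D)
    (c : ℝ) (hc : 0 < c) (x e : EuclideanSpace ℝ (Fin d))
    (u : EuclideanSpace ℝ (Fin d) → ℝ)
    (hu : ∀ z, u z = (if z ∈ D then ⟪z, e⟫ else 0) - c * ‖z - x‖ ^ 2)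
    (hz' : x + (1 / (2 * c)) • e ∈ D)
    (hval : ⟪x + (1 / (2 * c)) • e, e⟫ ≥ ‖e‖ ^ 2 / (4 * c)) :
    ∀ z, u z ≤ u (x + (1 / (2 * c)) • e) := by
  have hcost : c * ‖x + (1 / (2 * c)) • e - x‖ ^ 2 = ‖e‖ ^ 2 / (4 * c) := by
    rw [add_sub_cancel_left, norm_smul, mul_pow, Real.norm_eq_abs, sq_abs]
    field_simp
    ring
  intro z
  rw [hu, hu, if_pos hz', hcost]
  split_ifs with hz
  · have hcs : ⟪z - x, e⟫ ≤ ‖z - x‖ * ‖e‖ := real_inner_le_norm _ _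
    have hsq : ‖z - x‖ * ‖e‖ ≤ c * ‖z - x‖ ^ 2 + ‖e‖ ^ 2 / (4 * c) := by
      have h : c * ‖z - x‖ ^ 2 + ‖e‖ ^ 2 / (4 * c) - ‖z - x‖ * ‖e‖
          = (2 * c * ‖z - x‖ - ‖e‖) ^ 2 / (4 * c) := by
        field_simp
        ring
      have : 0 ≤ (2 * c * ‖z - x‖ - ‖e‖) ^ 2 / (4 * c) := by positivity
      linarith
    have hreward : ⟪x + (1 / (2 * c)) • e, e⟫ = ⟪x, e⟫ + 2 * (‖e‖ ^ 2 / (4 * c)) := by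
      rw [inner_add_left, real_inner_smul_left, real_inner_self_eq_norm_sq]
      field_simp
      ring
    rw [inner_sub_left] at hcs
    linarith
  · have : 0 ≤ c * ‖z - x‖ ^ 2 := by positivity
    linarith
end

section
/- Fix a social trend vector e ∈ ℝ^d with d ≥ 1. Consider the class H_F of real-valued functions on ℝ^d × (0, ∞) given by h_{w,b}(x, c) = 1[⟨w, x⟩ + b ≤ 0] · 1[⟨w, x⟩ + b > −⟨w, e⟩/(2c)] · ( (⟨w, e⟩/(2c))² − (⟨w, x⟩ + b)² ), ranging over w ∈ ℝ^d with ‖w‖ = 1 and b ∈ ℝ. Then the pseudo-dimension of H_F is less than 273 (d+3)² (ln(d+3))²; in particular H_F cannot P-shatter any set of ⌈273 (d+3)² (ln(d+3))²⌉ points. -/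
open scoped RealInnerProductSpace
open Classical

/-- A class `H` of real-valued functions P-shatters the points `pts 0, …, pts (N-1)`
if there are thresholds `γ i` such that every above/below pattern is realized. -/
def PShatters {Z : Type*} (H : Set (Z → ℝ)) {N : ℕ} (pts : Fin N → Z) : Prop :=
  ∃ γ : Fin N → ℝ, ∀ T : Finset (Fin N), ∃ h ∈ H, ∀ i : Fin N, γ i ≤ h (pts i) ↔ i ∈ T

/-- An exponential-weight form of the Sauer–Shelah bound: a set family all of whose shattered sets
have at most `k` elements has at most `(1 + x)ⁿ / xᵏ` members, for every `0 < x ≤ 1`. -/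
theorem card_mul_pow_le_of_shatters_card_le {α : Type*} [Fintype α] [DecidableEq α]
    (𝒜 : Finset (Finset α)) (k : ℕ) (h𝒜 : ∀ s, 𝒜.Shatters s → s.card ≤ k)
    {x : ℝ} (hx0 : 0 ≤ x) (hx1 : x ≤ 1) :
    (𝒜.card : ℝ) * x ^ k ≤ (1 + x) ^ Fintype.card α := by
  calc (𝒜.card : ℝ) * x ^ k ≤ (𝒜.shatterer.card : ℝ) * x ^ k :=
        mul_le_mul_of_nonneg_right (by exact_mod_cast 𝒜.card_le_card_shatterer) (pow_nonneg hx0 k)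
    _ = ∑ _s ∈ 𝒜.shatterer, x ^ k := by simp
    _ ≤ ∑ s ∈ 𝒜.shatterer, x ^ s.card := Finset.sum_le_sum fun s hs =>
        pow_le_pow_of_le_one hx0 hx1 (h𝒜 s (Finset.mem_shatterer.1 hs))
    _ ≤ ∑ s : Finset α, x ^ s.card :=
        Finset.sum_le_univ_sum_of_nonneg fun s => by positivity
    _ = (1 + x) ^ Fintype.card α := by
        have h := Finset.sum_pow_mul_eq_add_pow x 1 (Finset.univ : Finset α)
        simpa [add_comm] using h

/-- The positivity sets of vectors under linear functionals shatter at most as many points as the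
dimension of the space. -/
theorem card_le_finrank_of_shatters_nonneg {α P M : Type*} [Fintype α] [DecidableEq α]
    [AddCommGroup M] [Module ℝ M] [Module.Finite ℝ M] (L : α → M) (ev : P → M →ₗ[ℝ] ℝ)
    (𝒜 : Finset (Finset α)) (h𝒜 : ∀ t ∈ 𝒜, ∃ p, ∀ i, i ∈ t ↔ 0 ≤ ev p (L i))
    (s : Finset α) (hs : 𝒜.Shatters s) : s.card ≤ Module.finrank ℝ M := by
  by_contra! hlt
  have hdep : ¬ LinearIndependent ℝ (fun i : s => L i) := fun h => by
    have := h.fintype_card_le_finrank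
    simp at this
    omega
  obtain ⟨g, hg, j, hj⟩ := Fintype.not_linearIndependent_iff.1 hdep
  have key : ∀ a : s → ℝ, ∑ i, a i • L i = 0 → ∀ j, ¬ a j < 0 := by
    intro a ha j hj
    obtain ⟨u, hu, hsu⟩ := hs (t := ({i : s | 0 ≤ a i} : Finset s).map (.subtype _))
      (Finset.map_subtype_subset _)
    obtain ⟨p, hp⟩ := h𝒜 u hu
    have hiff : ∀ i : s, 0 ≤ ev p (L i) ↔ 0 ≤ a i := by
      intro i
      have h : (i : α) ∈ s ∩ u ↔ 0 ≤ a i := by rw [hsu]; simp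
      rw [← hp, ← h]
      simp
    have hsum : ∑ i, a i * ev p (L i) = 0 := by
      simpa using congrArg (ev p) ha
    refine (Finset.sum_pos' (fun i _ => ?_) ⟨j, Finset.mem_univ j, ?_⟩).ne' hsum
    · rcases le_or_gt 0 (a i) with h | h
      · exact mul_nonneg h ((hiff i).2 h)
      · exact mul_nonneg_of_nonpos_of_nonpos h.le (not_le.1 (mt (hiff i).1 h.not_ge)).le
    · exact mul_pos_of_neg_of_neg hj (not_le.1 (mt (hiff j).1 hj.not_ge))
  rcases lt_or_gt_of_ne hj with h | h
  · exact key g hg j h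
  · exact key (-g) (by simpa [-Finset.univ_eq_attach] using hg) j (by simpa using h)

/-- If every subset of `α` is determined by three positivity sets, each given by vectors of a
finite-dimensional space under linear functionals, then `α` has fewer than `20 * dim` points. -/
theorem card_lt_of_three_nonneg_patterns {α P M : Type*} [Fintype α] [DecidableEq α]
    [AddCommGroup M] [Module ℝ M] [Module.Finite ℝ M] (hM : 0 < Module.finrank ℝ M)
    (L : Fin 3 → α → M) (ev : P → M →ₗ[ℝ] ℝ) (R : (Fin 3 → Prop) → Prop)
    (h : ∀ T : Finset α, ∃ p, ∀ i, i ∈ T ↔ R fun j => 0 ≤ ev p (L j i)) :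
    Fintype.card α < 20 * Module.finrank ℝ M := by
  choose p hp using h
  set k := Module.finrank ℝ M
  set n := Fintype.card α
  let F : Fin 3 → Finset α → Finset α := fun j T => {i | 0 ≤ ev (p T) (L j i)}
  let 𝒜 : Fin 3 → Finset (Finset α) := fun j => Finset.univ.image (F j)
  have hinj : Function.Injective fun T j => F j T := by
    intro T T' hT
    ext i
    rw [hp T, hp T']
    have : ∀ j, 0 ≤ ev (p T) (L j i) ↔ 0 ≤ ev (p T') (L j i) := fun j => by
      have := Finset.ext_iff.1 (congrFun hT j) i
      simpa [F] using this
    simp only [this]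
  have hcard : 2 ^ n ≤ ∏ j, (𝒜 j).card := by
    rw [← Fintype.card_piFinset, ← Fintype.card_finset, ← Finset.card_univ]
    refine Finset.card_le_card_of_injOn (fun T j => F j T) (fun T _ => ?_) hinj.injOn
    simp [𝒜]
  have hbound : ∀ j, ((𝒜 j).card : ℝ) * (1 / 16) ^ k ≤ (1 + 1 / 16) ^ n := fun j =>
    card_mul_pow_le_of_shatters_card_le _ k
      (card_le_finrank_of_shatters_nonneg (L j) ev (𝒜 j) fun t ht => by
        obtain ⟨T, -, rfl⟩ := Finset.mem_image.1 ht
        exact ⟨p T, fun i => by simp [F]⟩) (by norm_num) (by norm_num)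
  have hprod : (2 : ℝ) ^ n * ((1 / 16) ^ k) ^ 3 ≤ ((1 + 1 / 16) ^ n) ^ 3 :=
    calc (2 : ℝ) ^ n * ((1 / 16) ^ k) ^ 3 ≤ (∏ j, ((𝒜 j).card : ℝ)) * ((1 / 16) ^ k) ^ 3 := by
          gcongr
          exact_mod_cast hcard
      _ = ∏ j, ((𝒜 j).card : ℝ) * (1 / 16) ^ k := by simp [Finset.prod_mul_distrib]
      _ ≤ ∏ _j : Fin 3, (1 + 1 / 16 : ℝ) ^ n :=
          Finset.prod_le_prod (fun j _ => by positivity) fun j _ => hbound j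
      _ = _ := by simp
  by_contra! hn
  have h1 : (8192 / 4913 : ℝ) ^ n ≤ 4096 ^ k := by
    have e1 : (8192 / 4913 : ℝ) ^ n * ((1 + 1 / 16) ^ n) ^ 3 = 2 ^ n := by
      rw [← pow_mul, mul_comm n 3, pow_mul, ← mul_pow]
      norm_num
    have e2 : (4096 : ℝ) ^ k * ((1 / 16) ^ k) ^ 3 = 1 := by
      rw [← pow_mul, mul_comm k 3, pow_mul, ← mul_pow]
      norm_num
    have h2 : (0 : ℝ) < ((1 + 1 / 16) ^ n) ^ 3 := by positivity
    refine le_of_mul_le_mul_right ?_ h2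
    calc (8192 / 4913 : ℝ) ^ n * ((1 + 1 / 16) ^ n) ^ 3
        = (4096 : ℝ) ^ k * (2 ^ n * ((1 / 16) ^ k) ^ 3) := by
          rw [e1]; linear_combination (-(2 : ℝ) ^ n) * e2
      _ ≤ _ := by gcongr
  have h2 : (4096 : ℝ) ^ k < (8192 / 4913 : ℝ) ^ n :=
    calc (4096 : ℝ) ^ k < ((8192 / 4913 : ℝ) ^ 20) ^ k :=
          pow_lt_pow_left₀ (by norm_num) (by norm_num) hM.ne'
      _ = (8192 / 4913 : ℝ) ^ (20 * k) := (pow_mul _ _ _).symm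
      _ ≤ _ := pow_le_pow_right₀ (by norm_num) hn
  exact absurd h1 h2.not_ge

/-- A value of the clipped difference of squares exceeds a positive threshold exactly when both
indicators are on and the difference of squares does. -/
theorem le_indicator_mul_sq_sub_sq_iff {s t γ : ℝ} (hγ : 0 < γ) :
    γ ≤ (if s ≤ 0 then (1 : ℝ) else 0) * (if s > -t then (1 : ℝ) else 0) * (t ^ 2 - s ^ 2) ↔
      0 ≤ -s ∧ ¬ 0 ≤ -(s + t) ∧ 0 ≤ t ^ 2 - s ^ 2 - γ := by
  by_cases h1 : s ≤ 0 <;> by_cases h2 : s > -t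
  · simp [h1, h2]
  · have h3 : ¬ -t < s := h2
    simp [h3, hγ]
  · simp [h1, hγ]
  · simp [h1, hγ]

theorem indicator_mul_sq_sub_sq_nonneg (s t : ℝ) :
    0 ≤ (if s ≤ 0 then (1 : ℝ) else 0) * (if s > -t then (1 : ℝ) else 0) * (t ^ 2 - s ^ 2) := by
  by_cases h1 : s ≤ 0 <;> by_cases h2 : s > -t
  · have : s ^ 2 ≤ t ^ 2 := by nlinarith
    simp [h1, h2, this]
  all_goals simp [h1, h2]

/-- the distortion-mitigation class induced by unit-normal linear
moderators, consisting of the functions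
`h_{w,b}(x, c) = 1[⟪w,x⟫+b ≤ 0] · 1[⟪w,x⟫+b > −⟪w,e⟫/(2c)] · ((⟪w,e⟫/(2c))² − (⟪w,x⟫+b)²)`
on `ℝ^d × (0, ∞)`, has pseudo-dimension less than `273 (d+3)² (ln(d+3))²`: it
cannot P-shatter any `N` points once `273 (d+3)² (ln(d+3))² ≤ N`. -/
theorem pdim_DM_linear_lt {d : ℕ} (hd : 1 ≤ d) (e : EuclideanSpace ℝ (Fin d)) :
    ∀ N : ℕ, 273 * ((d : ℝ) + 3) ^ 2 * Real.log ((d : ℝ) + 3) ^ 2 ≤ (N : ℝ) →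
      ∀ pts : Fin N → EuclideanSpace ℝ (Fin d) × {c : ℝ // 0 < c},
        ¬ PShatters
          {h | ∃ (w : EuclideanSpace ℝ (Fin d)) (b : ℝ), ‖w‖ = 1 ∧
            h = fun p : EuclideanSpace ℝ (Fin d) × {c : ℝ // 0 < c} =>
              (if ⟪w, p.1⟫ + b ≤ 0 then (1 : ℝ) else 0) *
              (if ⟪w, p.1⟫ + b > -(⟪w, e⟫ / (2 * (p.2 : ℝ))) then (1 : ℝ) else 0) *
              ((⟪w, e⟫ / (2 * (p.2 : ℝ))) ^ 2 - (⟪w, p.1⟫ + b) ^ 2)}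
          pts := by
  intro N hN pts
  rintro ⟨γ, hγ⟩
  have hpos : ∀ i, 0 < γ i := by
    intro i
    obtain ⟨h, ⟨w, b, -, rfl⟩, hh⟩ := hγ ∅
    have := mt (hh i).1 (Finset.notMem_empty i)
    exact (indicator_mul_sq_sub_sq_nonneg _ _).trans_lt (not_le.1 this)
  let V := EuclideanSpace ℝ (Fin d) × ℝ × ℝ
  let v : EuclideanSpace ℝ (Fin d) × ℝ → V := fun p => (p.1, p.2, 1)
  let υ : V →ₗ[ℝ] ℝ := LinearMap.snd ℝ ℝ ℝ ∘ₗ LinearMap.snd ℝ _ (ℝ × ℝ)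
  let σ : Fin N → V →ₗ[ℝ] ℝ := fun i =>
    (innerₗ _ (pts i).1) ∘ₗ LinearMap.fst ℝ _ (ℝ × ℝ) +
      LinearMap.fst ℝ ℝ ℝ ∘ₗ LinearMap.snd ℝ _ (ℝ × ℝ)
  let τ : Fin N → V →ₗ[ℝ] ℝ := fun i =>
    (1 / (2 * ((pts i).2 : ℝ))) • (innerₗ _ e) ∘ₗ LinearMap.fst ℝ _ (ℝ × ℝ)
  let L : Fin 3 → Fin N → V →ₗ[ℝ] V →ₗ[ℝ] ℝ :=
    ![fun i => -υ.smulRight (σ i), fun i => -υ.smulRight (σ i + τ i),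
      fun i => (τ i).smulRight (τ i) - (σ i).smulRight (σ i) - γ i • υ.smulRight υ]
  let ev : EuclideanSpace ℝ (Fin d) × ℝ → (V →ₗ[ℝ] V →ₗ[ℝ] ℝ) →ₗ[ℝ] ℝ := fun p =>
    LinearMap.applyₗ (v p) ∘ₗ LinearMap.applyₗ (v p)
  have hrank : Module.finrank ℝ (V →ₗ[ℝ] V →ₗ[ℝ] ℝ) = (d + 2) ^ 2 := by
    have hV : Module.finrank ℝ V = d + 2 := by simp [V]
    rw [Module.finrank_linearMap, Module.finrank_linearMap, hV]
    simp [sq]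
  have hlt := card_lt_of_three_nonneg_patterns (by rw [hrank]; positivity) L ev
    (fun q => q 0 ∧ ¬ q 1 ∧ q 2) (fun T => by
      obtain ⟨h, ⟨w, b, -, rfl⟩, hh⟩ := hγ T
      refine ⟨(w, b), fun i => ?_⟩
      rw [← hh i]
      have hσ : σ i (v (w, b)) = ⟪w, (pts i).1⟫ + b := by
        change ⟪(pts i).1, w⟫ + b = _
        rw [real_inner_comm]
      have hτ : τ i (v (w, b)) = ⟪w, e⟫ / (2 * ((pts i).2 : ℝ)) := by
        change 1 / (2 * ((pts i).2 : ℝ)) * ⟪e, w⟫ = _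
        rw [real_inner_comm, one_div_mul_eq_div]
      have hυ : υ (v (w, b)) = 1 := rfl
      refine (le_indicator_mul_sq_sub_sq_iff (hpos i)).trans ?_
      simp [L, ev, hσ, hτ, hυ, sq])
  rw [hrank, Fintype.card_fin] at hlt
  have hlog : 1 ≤ Real.log ((d : ℝ) + 3) := by
    rw [Real.le_log_iff_exp_le (by positivity)]
    have : (1 : ℝ) ≤ d := by exact_mod_cast hd
    linarith [Real.exp_one_lt_d9]
  have hlt' : (N : ℝ) < 20 * ((d : ℝ) + 2) ^ 2 := by exact_mod_cast hlt
  have hlog2 : 1 ≤ Real.log ((d : ℝ) + 3) ^ 2 := one_le_pow₀ hlog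
  have hd0 : (0 : ℝ) ≤ d := by positivity
  nlinarith [mul_le_mul_of_nonneg_left hlog2 (by positivity : 0 ≤ 273 * ((d : ℝ) + 3) ^ 2)]
end

section
/- Let α be a set, let F be a class of functions α → [−1, 1] with pseudo-dimension at most d_F, and let G be a class of functions α → {0, 1} with pseudo-dimension at most d_G, where d_F, d_G ≥ 1. Then the product class F ⊗ G = { x ↦ f(x) · g(x) : f ∈ F, g ∈ G } has pseudo-dimension strictly less than 3 (1 + ln(d_F · d_G)) (d_F + d_G). -/
open Classical in
/-- The above/below patterns that a class `H` realizes on `pts` with respect to thresholds `γ`. -/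
noncomputable def thresholdPatterns {Z : Type*} (H : Set (Z → ℝ)) {N : ℕ} (pts : Fin N → Z)
    (γ : Fin N → ℝ) : Finset (Finset (Fin N)) :=
  Finset.univ.filter fun A => ∃ h ∈ H, ∀ i, γ i ≤ h (pts i) ↔ i ∈ A

theorem mem_thresholdPatterns {Z : Type*} {H : Set (Z → ℝ)} {N : ℕ} {pts : Fin N → Z}
    {γ : Fin N → ℝ} {A : Finset (Fin N)} :
    A ∈ thresholdPatterns H pts γ ↔ ∃ h ∈ H, ∀ i, γ i ≤ h (pts i) ↔ i ∈ A := by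
  simp [thresholdPatterns]

theorem PShatters.of_shatters_thresholdPatterns {Z : Type*} {H : Set (Z → ℝ)} {N : ℕ}
    {pts : Fin N → Z} {γ : Fin N → ℝ} {s : Finset (Fin N)}
    (hs : (thresholdPatterns H pts γ).Shatters s) :
    PShatters H fun j : Fin s.card => pts (s.equivFin.symm j) := by
  refine ⟨fun j => γ (s.equivFin.symm j), fun T => ?_⟩
  obtain ⟨A, hA, hsA⟩ :=
    hs (t := T.image fun j => (s.equivFin.symm j : Fin N)) (by
      intro i hi
      obtain ⟨j, -, rfl⟩ := Finset.mem_image.1 hi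
      exact (s.equivFin.symm j).2)
  obtain ⟨h, hH, hh⟩ := mem_thresholdPatterns.1 hA
  refine ⟨h, hH, fun j => (hh _).trans ?_⟩
  have key := Finset.ext_iff.1 hsA (s.equivFin.symm j)
  simpa using key

/-- The Sauer–Shelah bound for classes of bounded pseudo-dimension. -/
theorem card_thresholdPatterns_le {Z : Type*} {H : Set (Z → ℝ)} {d : ℕ}
    (hH : ∀ N : ℕ, d < N → ∀ pts : Fin N → Z, ¬ PShatters H pts)
    {N : ℕ} (pts : Fin N → Z) (γ : Fin N → ℝ) :
    (thresholdPatterns H pts γ).card ≤ ∑ k ∈ Finset.Iic d, N.choose k := by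
  have hdim : (thresholdPatterns H pts γ).vcDim ≤ d :=
    Finset.sup_le fun s hs => not_lt.1 fun hlt =>
      hH _ hlt _ (PShatters.of_shatters_thresholdPatterns (Finset.mem_shatterer.1 hs))
  calc (thresholdPatterns H pts γ).card
      ≤ (thresholdPatterns H pts γ).shatterer.card := Finset.card_le_card_shatterer _
    _ ≤ ∑ k ∈ Finset.Iic (thresholdPatterns H pts γ).vcDim, N.choose k := by
        simpa using Finset.card_shatterer_le_sum_vcDim (𝒜 := thresholdPatterns H pts γ)
    _ ≤ ∑ k ∈ Finset.Iic d, N.choose k :=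
        Finset.sum_le_sum_of_subset (Finset.Iic_subset_Iic.2 hdim)

/-- A P-shattered set for a product class has few points compared with the number of patterns
of the factors, when the second factor takes values in `{0, 1}`. -/
theorem two_pow_le_of_pShatters_mul {α : Type*} {F G : Set (α → ℝ)}
    (hG : ∀ g ∈ G, ∀ x, g x = 0 ∨ g x = 1) {N : ℕ} {pts : Fin N → α}
    (h : PShatters {h | ∃ f ∈ F, ∃ g ∈ G, h = fun x => f x * g x} pts) :
    ∃ γ : Fin N → ℝ, 2 ^ N ≤
      (thresholdPatterns F pts γ).card * (thresholdPatterns G pts fun _ => 1 / 2).card := by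
  classical
  obtain ⟨γ, hγ⟩ := h
  refine ⟨γ, ?_⟩
  let combine : Finset (Fin N) × Finset (Fin N) → Finset (Fin N) := fun P =>
    Finset.univ.filter fun i => (γ i ≤ 0 ∧ i ∉ P.2) ∨ (i ∈ P.1 ∧ i ∈ P.2)
  have hsub : (Finset.univ : Finset (Finset (Fin N))) ⊆
      (thresholdPatterns F pts γ ×ˢ thresholdPatterns G pts fun _ => 1 / 2).image combine := by
    intro T _
    obtain ⟨_, ⟨f, hf, g, hg, rfl⟩, hT⟩ := hγ T
    refine Finset.mem_image.2 ⟨(Finset.univ.filter fun i => γ i ≤ f (pts i),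
      Finset.univ.filter fun i => 1 / 2 ≤ g (pts i)), Finset.mem_product.2
        ⟨mem_thresholdPatterns.2 ⟨f, hf, by simp⟩, mem_thresholdPatterns.2 ⟨g, hg, by simp⟩⟩, ?_⟩
    ext i
    rw [← hT i]
    rcases hG g hg (pts i) with h0 | h1
    · simp [combine, h0]
    · have : (2 : ℝ)⁻¹ ≤ 1 := by norm_num
      simp [combine, h1, this]
  calc 2 ^ N = (Finset.univ : Finset (Finset (Fin N))).card := by simp
    _ ≤ _ := (Finset.card_le_card hsub).trans Finset.card_image_le
    _ = _ := Finset.card_product _ _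

/-- An exponential-moment bound for the lower tail of the binomial coefficients. -/
theorem sum_Iic_choose_le_pow_mul {c : ℝ} (hc : 1 ≤ c) (N d : ℕ) :
    (∑ k ∈ Finset.Iic d, (N.choose k : ℝ)) ≤ c ^ d * (1 + c⁻¹) ^ N := by
  have hc0 : 0 < c := one_pos.trans_le hc
  have hbinom : (1 + c⁻¹) ^ N = ∑ k ∈ Finset.range (N + 1), c⁻¹ ^ k * (N.choose k : ℝ) := by
    rw [add_comm, add_pow]
    simp
  have hle : ∑ k ∈ Finset.Iic d, c⁻¹ ^ k * (N.choose k : ℝ) ≤ (1 + c⁻¹) ^ N := by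
    rw [hbinom, ← Finset.sum_filter_add_sum_filter_not (Finset.Iic d) (· ∈ Finset.range (N + 1)),
      Finset.sum_eq_zero (s := Finset.filter (· ∉ Finset.range (N + 1)) _), add_zero]
    · refine Finset.sum_le_sum_of_subset_of_nonneg (fun k hk => (Finset.mem_filter.1 hk).2) ?_
      intros
      positivity
    · intro k hk
      have hNk : N < k := by simpa using (Finset.mem_filter.1 hk).2
      simp [Nat.choose_eq_zero_of_lt hNk]
  refine le_trans ?_ (mul_le_mul_of_nonneg_left hle (by positivity))
  rw [Finset.mul_sum]
  refine Finset.sum_le_sum fun k hk => ?_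
  have hone : 1 ≤ c ^ d * c⁻¹ ^ k := by
    rw [inv_pow, ← div_eq_mul_inv, one_le_div (by positivity)]
    exact pow_le_pow_right₀ hc (Finset.mem_Iic.1 hk)
  rw [← mul_assoc]
  exact le_mul_of_one_le_left (by positivity) hone

theorem sum_choose_mul_sum_choose_lt_two_pow {a b N : ℕ} (hab : 0 < a + b)
    (hN : 5 * (a + b) ≤ N) :
    (∑ k ∈ Finset.Iic a, (N.choose k : ℝ)) * ∑ k ∈ Finset.Iic b, (N.choose k : ℝ) < 2 ^ N := by
  have ha := sum_Iic_choose_le_pow_mul (c := 8) (by norm_num) N a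
  have hb := sum_Iic_choose_le_pow_mul (c := 8) (by norm_num) N b
  have hpow : (8 : ℝ) ^ (a + b) < (128 / 81) ^ N :=
    calc (8 : ℝ) ^ (a + b) < ((128 / 81) ^ 5) ^ (a + b) :=
          pow_lt_pow_left₀ (by norm_num) (by norm_num) hab.ne'
      _ = (128 / 81) ^ (5 * (a + b)) := (pow_mul _ _ _).symm
      _ ≤ (128 / 81) ^ N := pow_le_pow_right₀ (by norm_num) hN
  calc _ ≤ ((8 : ℝ) ^ a * (1 + 8⁻¹) ^ N) * (8 ^ b * (1 + 8⁻¹) ^ N) :=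
        mul_le_mul ha hb (by positivity) (by positivity)
    _ = 8 ^ (a + b) * (81 / 64) ^ N := by
        rw [mul_mul_mul_comm, ← pow_add, ← mul_pow]
        norm_num
    _ < (128 / 81) ^ N * (81 / 64) ^ N := by gcongr
    _ = 2 ^ N := by
        rw [← mul_pow]
        norm_num

theorem sq_add_one_lt_two_pow {N : ℕ} (hN : 6 ≤ N) : (N + 1) * (N + 1) < 2 ^ N := by
  induction N, hN using Nat.le_induction with
  | base => norm_num
  | succ n hn ih =>
    rw [pow_succ]
    nlinarith

/-- if `F` maps into `[−1, 1]` with pseudo-dimension at most `d_F ≥ 1`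
and `G` maps into `{0, 1}` with pseudo-dimension at most `d_G ≥ 1`, then the
product class `F ⊗ G = {x ↦ f(x)·g(x)}` has pseudo-dimension strictly less than
`3 (1 + ln(d_F·d_G)) (d_F + d_G)`. -/
theorem pdim_product_lt {α : Type*} (F G : Set (α → ℝ)) (dF dG : ℕ)
    (hdF : 1 ≤ dF) (hdG : 1 ≤ dG)
    (hFrange : ∀ f ∈ F, ∀ x, f x ∈ Set.Icc (-1 : ℝ) 1)
    (hGrange : ∀ g ∈ G, ∀ x, g x = 0 ∨ g x = 1)
    (hF : ∀ N : ℕ, dF < N → ∀ pts : Fin N → α, ¬ PShatters F pts)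
    (hG : ∀ N : ℕ, dG < N → ∀ pts : Fin N → α, ¬ PShatters G pts) :
    ∀ N : ℕ, 3 * (1 + Real.log ((dF : ℝ) * (dG : ℝ))) * ((dF : ℝ) + (dG : ℝ)) ≤ (N : ℝ) →
      ∀ pts : Fin N → α,
        ¬ PShatters {h | ∃ f ∈ F, ∃ g ∈ G, h = fun x => f x * g x} pts := by
  intro N hN pts hsh
  obtain ⟨γ, hγ⟩ := two_pow_le_of_pShatters_mul hGrange hsh
  have hcard := hγ.trans (Nat.mul_le_mul (card_thresholdPatterns_le hF pts γ)
    (card_thresholdPatterns_le hG pts fun _ => 1 / 2))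
  rcases eq_or_lt_of_le (one_le_mul hdF hdG) with hone | htwo
  · obtain ⟨rfl, rfl⟩ := mul_eq_one.1 hone.symm
    have hN6 : 6 ≤ N := by
      norm_num at hN
      exact_mod_cast hN
    have hsum : ∑ k ∈ Finset.Iic 1, N.choose k = N + 1 := by
      rw [← Nat.range_succ_eq_Iic]
      simp [Finset.sum_range_succ, add_comm]
    rw [hsum] at hcard
    exact (sq_add_one_lt_two_pow hN6).not_ge hcard
  · have hlog : Real.log 2 ≤ Real.log ((dF : ℝ) * dG) :=
      Real.log_le_log two_pos (by exact_mod_cast htwo)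
    have hN5 : 5 * (dF + dG) ≤ N := by
      have hlog_two := Real.log_two_gt_d9
      have : (5 : ℝ) * (dF + dG) ≤ N := le_trans (by gcongr; linarith) hN
      exact_mod_cast this
    exact (sum_choose_mul_sum_choose_lt_two_pow (by omega) hN5).not_ge (by exact_mod_cast hcard)
end

section
/- Let α be a set, let F be a set of functions α → ℝ, and let G be a set of functions α → {0, 1}. Fix m points x₁, …, x_m ∈ α and thresholds y₁, …, y_m ∈ ℝ. Then the number of distinct Boolean patterns { ( 1[f(x₁)·g(x₁) ≥ y₁], …, 1[f(x_m)·g(x_m) ≥ y_m] ) : f ∈ F, g ∈ G } is at most the product of the number of distinct patterns { ( 1[f(x₁) ≥ y₁], …, 1[f(x_m) ≥ y_m] ) : f ∈ F } and the number of distinct patterns { ( g(x₁), …, g(x_m) ) : g ∈ G }. -/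
open Classical

/-- the number of distinct Boolean patterns realized by the
product class `{x ↦ f(x)·g(x)}` on fixed points `x₁, …, x_m` with thresholds
`y₁, …, y_m` is at most the number of patterns of `F` times the number of
value patterns of the `{0,1}`-valued class `G`. -/
theorem pattern_count_product_le {α : Type*} (F G : Set (α → ℝ))
    (hGrange : ∀ g ∈ G, ∀ z, g z = 0 ∨ g z = 1)
    (m : ℕ) (x : Fin m → α) (y : Fin m → ℝ) :
    Set.ncard {p : Fin m → Bool | ∃ f ∈ F, ∃ g ∈ G,
        ∀ i : Fin m, p i = true ↔ y i ≤ f (x i) * g (x i)} ≤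
      Set.ncard {p : Fin m → Bool | ∃ f ∈ F,
          ∀ i : Fin m, p i = true ↔ y i ≤ f (x i)} *
        Set.ncard {p : Fin m → ℝ | ∃ g ∈ G, ∀ i : Fin m, p i = g (x i)} := by
  set P := {p : Fin m → Bool | ∃ f ∈ F, ∀ i : Fin m, p i = true ↔ y i ≤ f (x i)}
  set Q := {p : Fin m → ℝ | ∃ g ∈ G, ∀ i : Fin m, p i = g (x i)}
  have hQ : Q.Finite := by
    refine (Set.Finite.pi' fun _ : Fin m => Set.toFinite ({0, 1} : Set ℝ)).subset ?_
    rintro q ⟨g, hg, hq⟩ i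
    rw [hq i]
    exact hGrange g hg (x i)
  have hPQ : (P ×ˢ Q).Finite := P.toFinite.prod hQ
  let combine : (Fin m → Bool) × (Fin m → ℝ) → Fin m → Bool :=
    fun pq i => if pq.2 i = 1 then pq.1 i else decide (y i ≤ 0)
  rw [← Set.ncard_prod]
  refine (Set.ncard_le_ncard ?_ (hPQ.image combine)).trans (Set.ncard_image_le hPQ)
  rintro p ⟨f, hf, g, hg, hp⟩
  refine ⟨(fun i => decide (y i ≤ f (x i)), fun i => g (x i)),
    ⟨⟨f, hf, fun i => decide_eq_true_iff⟩, ⟨g, hg, fun _ => rfl⟩⟩, ?_⟩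
  funext i
  rw [Bool.eq_iff_iff, hp i]
  rcases hGrange g hg (x i) with h | h <;> simp [combine, h]
end

section
/- For all real numbers a and m with a ≥ 2 and m > (1.59 a / ln 2) · (ln a − ln(ln 2)), it holds that 2^m > m^a. -/
/-- The graph of `log` lies below its tangent through the origin, of slope `1 / e < 0.37`. -/
lemma Real.log_lt_const_mul {s : ℝ} (hs : 0 < s) : Real.log s < 0.37 * s := by
  have h := Real.log_le_sub_one_of_pos (div_pos hs (Real.exp_pos 1))
  rw [Real.log_div hs.ne' (Real.exp_pos 1).ne', Real.log_exp] at h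
  have h' : s / Real.exp 1 < 0.37 * s := by
    rw [div_lt_iff₀ (Real.exp_pos 1)]
    nlinarith [Real.exp_one_gt_d9]
  linarith

/-- Lemma `2mma`: for real `a ≥ 2` and
`m > (1.59 a / ln 2)·(ln a − ln(ln 2))`, one has `2^m > m^a`. -/
theorem two_rpow_gt_rpow (a m : ℝ) (ha : 2 ≤ a)
    (hm : m > 1.59 * a / Real.log 2 * (Real.log a - Real.log (Real.log 2))) :
    (2 : ℝ) ^ m > m ^ a := by
  have ha0 : 0 < a := by linarith
  have hl : 0 < Real.log 2 := Real.log_pos one_lt_two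
  set u := a / Real.log 2 with hu
  have hu0 : 0 < u := div_pos ha0 hl
  have hau : a = u * Real.log 2 := by rw [hu]; field_simp
  have hlogu : Real.log a - Real.log (Real.log 2) = Real.log u :=
    (Real.log_div ha0.ne' hl.ne').symm
  have hu1 : 1 < u := by
    rw [hu, one_lt_div hl]
    linarith [Real.log_two_lt_d9]
  have ht : 0 < Real.log u := Real.log_pos hu1
  rw [hlogu, mul_div_assoc, ← hu] at hm
  have hm0 : 0 < m := lt_trans (by positivity) hm
  have hs : 1.59 * Real.log u < m / u := by
    rw [lt_div_iff₀ hu0]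
    linarith
  have hlogm : Real.log m < m / u := by
    have h := Real.log_lt_const_mul (div_pos hm0 hu0)
    rw [Real.log_div hm0.ne' hu0.ne'] at h
    linarith
  rw [lt_div_iff₀ hu0] at hlogm
  rw [gt_iff_lt, Real.rpow_def_of_pos hm0, Real.rpow_def_of_pos two_pos, Real.exp_lt_exp, hau]
  nlinarith
end

section
/- Let S be a finite set with |S| = 3n, let C₁, …, C_m ⊆ S with |C_j| = 3 for each j, and let ε > 0. Suppose C' ⊆ {1, …, m} indexes an exact cover: every s ∈ S belongs to exactly one C_j with j ∈ C' (hence |C'| = n). Define x ∈ ℝ^{m+1} by x_j = −ε if j ∈ C' or j = m+1, and x_j = 0 otherwise. Then: (i) for every s ∈ S, ∑_{j ≤ m, s ∈ C_j} x_j − x_{m+1} = 0, so all 3n coverage equations hold; (ii) for every j ≤ m, exactly one of the equations x_j − x_{m+1} = 0 and x_j = 0 holds, so exactly 3n + m of the 3n + 2m optional equality constraints are satisfied; and (iii) the number of violated mandatory inequality constraints among { ∑_{j ≤ m, s ∈ C_j} x_j − x_{m+1} ≤ −ε : s ∈ S } ∪ { x_j − x_{m+1} ≤ −ε : j ≤ m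 } ∪ { x_j ≤ −ε : j ≤ m } equals exactly 2n + 2m. -/
open Classical

/-- An exact cover of a finite set by subsets of common size `k` has `k * #C' = #S`. -/
theorem card_mul_eq_card_of_exact_cover {ι α : Type*} {S : Finset α} {C : ι → Finset α}
    {C' : Finset ι} {k : ℕ} (hCsub : ∀ j, C j ⊆ S) (hCcard : ∀ j, (C j).card = k)
    (hcover : ∀ s ∈ S, ∃! j, j ∈ C' ∧ s ∈ C j) : C'.card * k = S.card := by
  have hunion : C'.biUnion C = S := by
    ext s
    simp only [Finset.mem_biUnion]
    exact ⟨fun ⟨j, _, hs⟩ => hCsub j hs, fun hs => (hcover s hs).exists⟩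
  rw [← hunion, Finset.card_biUnion, Finset.sum_const_nat fun j _ => hCcard j]
  intro i hi j hj hij
  refine Finset.disjoint_left.2 fun s hsi hsj => hij ?_
  exact (hcover s (hCsub i hsi)).unique ⟨hi, hsi⟩ ⟨hj, hsj⟩

/-- forward direction of the reduction from Exact 3-Set Cover.
Given an exact cover `C'` of a set `S` of `3n` elements by 3-element subsets
`C 1, …, C m`, the vector `x` with `x j = −ε` for `j ∈ C'` (and `x_{m+1} = −ε`,
`x j = 0` otherwise) satisfies (i) all `3n` coverage equations, (ii) for each
`j` exactly one of `x j − x_{m+1} = 0` and `x j = 0` (so exactly `3n + m`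
optional equality constraints hold), and (iii) exactly `2n + 2m` of the
mandatory inequality constraints are violated. -/
theorem exact_cover_to_maxfls {α : Type*} [DecidableEq α]
    (n m : ℕ) (S : Finset α) (hS : S.card = 3 * n)
    (C : Fin m → Finset α) (hCsub : ∀ j, C j ⊆ S) (hCcard : ∀ j, (C j).card = 3)
    (ε : ℝ) (hε : 0 < ε)
    (C' : Finset (Fin m))
    (hcover : ∀ s ∈ S, ∃! j : Fin m, j ∈ C' ∧ s ∈ C j)
    (x : Fin m → ℝ) (hx : ∀ j, x j = if j ∈ C' then -ε else 0) :
    (∀ s ∈ S, (∑ j ∈ Finset.univ.filter fun j : Fin m => s ∈ C j, x j) - (-ε) = 0) ∧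
    ((∀ j : Fin m, Xor' (x j - (-ε) = 0) (x j = 0)) ∧
      (Finset.univ.filter fun j : Fin m => x j - (-ε) = 0).card +
        (Finset.univ.filter fun j : Fin m => x j = 0).card = m) ∧
    (S.filter fun s =>
        ¬ ((∑ j ∈ Finset.univ.filter fun j : Fin m => s ∈ C j, x j) - (-ε) ≤ -ε)).card +
      (Finset.univ.filter fun j : Fin m => ¬ (x j - (-ε) ≤ -ε)).card +
      (Finset.univ.filter fun j : Fin m => ¬ (x j ≤ -ε)).card = 2 * n + 2 * m := by
  have hcard := card_mul_eq_card_of_exact_cover hCsub hCcard hcover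
  have hcompl : C'.card + C'ᶜ.card = m := by simp
  have hsum : ∀ s ∈ S,
      (∑ j ∈ Finset.univ.filter fun j : Fin m => s ∈ C j, x j) - (-ε) = 0 := by
    intro s hs
    obtain ⟨i, ⟨hi, hsi⟩, huniq⟩ := hcover s hs
    rw [Finset.sum_eq_single_of_mem i (by simpa using hsi), hx, if_pos hi, sub_self]
    intro j hj hji
    rw [hx, if_neg fun hj' => hji (huniq j ⟨hj', by simpa using hj⟩)]
  have hpos : ∀ j, x j - (-ε) = 0 ↔ j ∈ C' := by
    intro j
    by_cases hj : j ∈ C' <;> simp [hx, hj, hε.ne']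
  have hzero : ∀ j, x j = 0 ↔ j ∈ C'ᶜ := by
    intro j
    by_cases hj : j ∈ C' <;> simp [hx, hj, hε.ne']
  have hdiff : ∀ j, ¬ (x j - (-ε) ≤ -ε) := by
    intro j
    rw [hx]
    split_ifs <;> linarith
  have hle : ∀ j, ¬ (x j ≤ -ε) ↔ j ∈ C'ᶜ := by
    intro j
    by_cases hj : j ∈ C' <;> simp [hx, hj, hε]
  refine ⟨hsum, ⟨fun j => ?_, ?_⟩, ?_⟩
  · rw [hpos, hzero, Finset.mem_compl]
    by_cases hj : j ∈ C'
    · exact Or.inl ⟨hj, not_not_intro hj⟩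
    · exact Or.inr ⟨hj, hj⟩
  · simp only [hpos, hzero, Finset.filter_univ_mem]
    exact hcompl
  · rw [Finset.filter_true_of_mem fun s hs => by rw [hsum s hs]; linarith,
      Finset.filter_true_of_mem fun j _ => hdiff j]
    simp only [hle, Finset.filter_univ_mem, Finset.card_univ, Fintype.card_fin]
    omega
end
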